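/- arXiv:1409.4849 — 2 statements merged into one kernel-verified Lean document; each statement's English description precedes it below -/
import Mathlib

section
/- Let P be a polynomial with real nonnegative coefficients of degree d ≥ 1, and let α ∈ (0, π/2). Then the number of roots of P, counted with multiplicity, lying in the sector {z ∈ ℂ, z ≠ 0 : |Arg z| ≤ α} is at most 2αd/π. -/
open Polynomial in
/-- If the indices of the nonzero coefficients are split into at most `j + 1` consecutive blocks
on which the coefficients have constant sign, then there are at most `j` sign variations. -/
theorem Polynomial.signVariations_le_of_monotone_index (Q : ℝ[X]) (g : ℕ → ℕ) (hg : Monotone g)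
    (j : ℕ) (hle : ∀ k, Q.coeff k ≠ 0 → g k ≤ j)
    (hsign : ∀ k l, Q.coeff k ≠ 0 → Q.coeff l ≠ 0 → g k = g l →
      SignType.sign (Q.coeff k) = SignType.sign (Q.coeff l)) :
    Q.signVariations ≤ j := by
  unfold signVariations
  rw [Nat.sub_le_iff_le_add]
  set L := ((Q.coeffList.map SignType.sign).filter (· ≠ 0)) with hL
  have hL' : L = ((List.range Q.degree.succ).reverse.filter
      (fun k => SignType.sign (Q.coeff k) ≠ 0)).map (fun k => SignType.sign (Q.coeff k)) := by
    rw [hL, coeffList, List.map_map, List.filter_map]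
    rfl
  have hsub := L.destutter_sublist (· ≠ ·)
  have hchain := L.isChain_destutter (· ≠ ·)
  generalize L.destutter (· ≠ ·) = D at hsub hchain ⊢
  rw [hL', List.sublist_map_iff] at hsub
  obtain ⟨K, hK, rfl⟩ := hsub
  have hKnz : ∀ k ∈ K, Q.coeff k ≠ 0 := fun k hk => by
    have := List.of_mem_filter (hK.subset hk)
    simpa using this
  have hKsort : K.Pairwise (· > ·) := by
    refine List.Pairwise.sublist (hK.trans List.filter_sublist) ?_
    rw [List.pairwise_reverse]
    exact List.pairwise_lt_range
  have hgchain : (K.map g).IsChain (· > ·) := by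
    rw [List.isChain_map] at hchain ⊢
    rw [List.isChain_iff_getElem] at hchain ⊢
    intro i hi
    have h1 := hchain i hi
    have h2 : K[i] > K[i + 1] := List.pairwise_iff_getElem.mp hKsort i (i + 1) _ _ (by lia)
    refine lt_of_le_of_ne (hg h2.le) fun h => h1 ?_
    exact hsign _ _ (hKnz _ (List.getElem_mem _)) (hKnz _ (List.getElem_mem _)) h.symm
  have hnodup : (K.map g).Nodup := hgchain.pairwise.imp (fun h => ne_of_gt h)
  rw [List.length_map, ← List.length_map (f := g), ← List.toFinset_card_of_nodup hnodup]
  calc (K.map g).toFinset.card ≤ (Finset.range (j + 1)).card := by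
        refine Finset.card_le_card fun x hx => ?_
        simp only [List.mem_toFinset, List.mem_map] at hx
        obtain ⟨k, hk, rfl⟩ := hx
        exact Finset.mem_range.mpr (Nat.lt_succ_of_le (hle k (hKnz k hk)))
    _ = j + 1 := Finset.card_range _

/-- The sign of `sin x` at a non-zero only depends on `⌊x / π⌋₊`. -/
theorem Real.sign_sin_eq_of_floor_eq {x y : ℝ} (hx : 0 ≤ x) (hy : 0 ≤ y)
    (hx0 : Real.sin x ≠ 0) (hy0 : Real.sin y ≠ 0)
    (h : ⌊x / Real.pi⌋₊ = ⌊y / Real.pi⌋₊) :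
    SignType.sign (Real.sin x) = SignType.sign (Real.sin y) := by
  have key : ∀ t : ℝ, 0 ≤ t → Real.sin t ≠ 0 →
      0 < (-1 : ℝ) ^ ⌊t / Real.pi⌋₊ * Real.sin t := by
    intro t ht ht0
    have h1 := Nat.floor_le (div_nonneg ht Real.pi_pos.le)
    have h2 := Nat.lt_floor_add_one (t / Real.pi)
    rw [le_div_iff₀ Real.pi_pos] at h1
    rw [div_lt_iff₀ Real.pi_pos] at h2
    rw [← Real.sin_sub_nat_mul_pi]
    refine lt_of_le_of_ne
      (Real.sin_nonneg_of_nonneg_of_le_pi (by linarith) (by linarith)) fun h => ?_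
    rw [Real.sin_sub_nat_mul_pi] at h
    exact (mul_ne_zero (pow_ne_zero _ (by norm_num)) ht0) h.symm
  have h1 := key x hx hx0
  have h2 := key y hy hy0
  rw [h] at h1
  rcases neg_one_pow_eq_or ℝ ⌊y / Real.pi⌋₊ with hs | hs <;> rw [hs] at h1 h2
  · rw [sign_pos (by linarith), sign_pos (by linarith)]
  · rw [_root_.sign_neg (by linarith), _root_.sign_neg (by linarith)]

/-- The argument of `-z * exp (-iα)`, shifted by `α`. -/
theorem Complex.arg_neg_mul_exp_of_lt {z : ℂ} (hz : z ≠ 0) {α : ℝ}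
    (hα : α ∈ Set.Ioo 0 (Real.pi / 2)) (h : Complex.arg z < α) :
    Complex.arg (-(z * Complex.exp (-(α * Complex.I)))) = Complex.arg z - α + Real.pi := by
  have hm := Complex.neg_pi_lt_arg z
  have hpi := Real.pi_pos
  obtain ⟨h0, h1⟩ := hα
  have : -(z * Complex.exp (-(α * Complex.I))) = (‖z‖ : ℂ) *
      (Complex.cos ((Complex.arg z - α + Real.pi : ℝ)) +
        Complex.sin ((Complex.arg z - α + Real.pi : ℝ)) * Complex.I) := by
    rw [← Complex.exp_mul_I]
    conv_lhs => rw [← Complex.norm_mul_exp_arg_mul_I z]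
    push_cast
    rw [show ((Complex.arg z : ℂ) - α + Real.pi) * Complex.I =
      Complex.arg z * Complex.I + -(α * Complex.I) + Real.pi * Complex.I by ring,
      Complex.exp_add, Complex.exp_add, Complex.exp_pi_mul_I]
    ring
  rw [this, Complex.arg_mul_cos_add_sin_mul_I (norm_pos_iff.mpr hz)]
  constructor <;> linarith

theorem Complex.arg_neg_mul_exp_of_gt {z : ℂ} (hz : z ≠ 0) {α : ℝ}
    (hα : α ∈ Set.Ioo 0 (Real.pi / 2)) (h : α < Complex.arg z) :
    Complex.arg (-(z * Complex.exp (-(α * Complex.I)))) = Complex.arg z - α - Real.pi := by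
  have hm := Complex.arg_le_pi z
  have hpi := Real.pi_pos
  obtain ⟨h0, h1⟩ := hα
  have : -(z * Complex.exp (-(α * Complex.I))) = (‖z‖ : ℂ) *
      (Complex.cos ((Complex.arg z - α - Real.pi : ℝ)) +
        Complex.sin ((Complex.arg z - α - Real.pi : ℝ)) * Complex.I) := by
    rw [← Complex.exp_mul_I]
    conv_lhs => rw [← Complex.norm_mul_exp_arg_mul_I z]
    push_cast
    rw [show ((Complex.arg z : ℂ) - α - Real.pi) * Complex.I =
      Complex.arg z * Complex.I + -(α * Complex.I) + -(Real.pi * Complex.I) by ring,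
      Complex.exp_add, Complex.exp_add, Complex.exp_neg (Real.pi * Complex.I),
      Complex.exp_pi_mul_I]
    ring
  rw [this, Complex.arg_mul_cos_add_sin_mul_I (norm_pos_iff.mpr hz)]
  constructor <;> linarith

/-- A continuous determination of the argument of `r * exp (iα) - z`, as a function of `r ≥ 0`,
valid when `z` is not on the ray of argument `α`. -/
noncomputable def rayArg (α : ℝ) (z : ℂ) (r : ℝ) : ℝ :=
  α + Complex.arg (r - z * Complex.exp (-(α * Complex.I)))

theorem rayArg_zero_add_conj {α : ℝ} (hα : α ∈ Set.Ioo 0 (Real.pi / 2)) {z : ℂ}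
    (hz : z ≠ 0 → |Complex.arg z| ≠ α) :
    2 * (if z ≠ 0 ∧ |Complex.arg z| ≤ α then Real.pi else 0) ≤
      rayArg α z 0 + rayArg α (starRingEnd ℂ z) 0 := by
  have hpi := Real.pi_pos
  have h0 := hα.1
  have h1 := hα.2
  by_cases hz0 : z = 0
  · simp [hz0, rayArg, h0.le]
  have hc0 : starRingEnd ℂ z ≠ 0 := by simpa using hz0
  have hzα := hz hz0
  have hlt : ∀ w : ℂ, w ≠ 0 → Complex.arg w < α → rayArg α w 0 = Complex.arg w + Real.pi := by
    intro w hw h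
    simp only [rayArg, Complex.ofReal_zero, zero_sub]
    rw [Complex.arg_neg_mul_exp_of_lt hw hα h]; ring
  have hgt : ∀ w : ℂ, w ≠ 0 → α < Complex.arg w → rayArg α w 0 = Complex.arg w - Real.pi := by
    intro w hw h
    simp only [rayArg, Complex.ofReal_zero, zero_sub]
    rw [Complex.arg_neg_mul_exp_of_gt hw hα h]; ring
  have hconj := Complex.arg_conj z
  by_cases hπ : Complex.arg z = Real.pi
  · rw [if_pos hπ] at hconj
    rw [hgt z hz0 (by linarith), hgt _ hc0 (by linarith), if_neg, hconj, hπ]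
    · simp
    · rw [hπ, abs_of_pos hpi]; intro h; linarith [h.2]
  rw [if_neg hπ] at hconj
  rcases lt_or_gt_of_ne hzα with h | h
  · rw [abs_lt] at h
    rw [hlt z hz0 h.2, hlt _ hc0 (by linarith), hconj]
    split_ifs <;> linarith
  · rw [if_neg (fun h' => absurd h'.2 (not_le.mpr h))]
    rcases lt_abs.mp h with h | h
    · rw [hgt z hz0 h, hlt _ hc0 (by linarith), hconj]; linarith
    · rw [hlt z hz0 (by linarith), hgt _ hc0 (by linarith), hconj]; linarith

theorem mul_exp_sub_eq_norm_mul_exp_rayArg (α : ℝ) (z : ℂ) (r : ℝ) :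
    r * Complex.exp (α * Complex.I) - z =
      (‖(r : ℂ) - z * Complex.exp (-(α * Complex.I))‖ : ℝ) *
        Complex.exp (rayArg α z r * Complex.I) := by
  have h := Complex.norm_mul_exp_arg_mul_I ((r : ℂ) - z * Complex.exp (-(α * Complex.I)))
  rw [rayArg, Complex.ofReal_add, add_mul, Complex.exp_add, mul_left_comm, h, mul_sub,
    mul_left_comm, ← Complex.exp_add, add_neg_cancel, Complex.exp_zero]
  ring

theorem continuousOn_rayArg {α : ℝ} (hα : α ∈ Set.Ioo 0 (Real.pi / 2)) {z : ℂ}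
    (hz : z ≠ 0 → |Complex.arg z| ≠ α) : ContinuousOn (rayArg α z) (Set.Ici 0) := by
  have hpi := Real.pi_pos
  by_cases hz0 : z = 0
  · refine (continuousOn_const (c := α)).congr fun r hr => ?_
    simp [rayArg, hz0, Complex.arg_ofReal_of_nonneg hr]
  intro r hr
  have hr : 0 ≤ r := hr
  refine ContinuousAt.continuousWithinAt ?_
  unfold rayArg
  refine continuousAt_const.add (ContinuousAt.comp (f := fun r : ℝ =>
    ((r : ℂ) - z * Complex.exp (-(α * Complex.I)))) (Complex.continuousAt_arg ?_) (by fun_prop))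
  by_contra hns
  rw [Complex.mem_slitPlane_iff, not_or, not_lt, not_not] at hns
  set w := z * Complex.exp (-(α * Complex.I)) with hw
  have hwim : w.im = 0 := by simpa using hns.2
  have hwre : 0 ≤ w.re := by
    have : r - w.re ≤ 0 := by simpa using hns.1
    linarith
  have hwr : w = (w.re : ℂ) := Complex.ext (by simp) (by simp [hwim])
  have hzw : z = (w.re : ℂ) * (Complex.cos α + Complex.sin α * Complex.I) := by
    rw [← hwr, ← Complex.exp_mul_I, hw, mul_assoc, ← Complex.exp_add, neg_add_cancel,
      Complex.exp_zero, mul_one]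
  have hpos : 0 < w.re := by
    refine lt_of_le_of_ne hwre fun h => hz0 ?_
    rw [hzw, ← h]; simp
  refine hz hz0 ?_
  rw [hzw, Complex.arg_mul_cos_add_sin_mul_I hpos
    ⟨by linarith [hα.1], by linarith [hα.2]⟩, abs_of_pos hα.1]

theorem tendsto_rayArg_atTop (α : ℝ) (z : ℂ) :
    Filter.Tendsto (rayArg α z) Filter.atTop (nhds α) := by
  set w := z * Complex.exp (-(α * Complex.I)) with hw
  have h1 : Filter.Tendsto (fun r : ℝ => (1 : ℂ) - w * ((r⁻¹ : ℝ) : ℂ)) Filter.atTop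
      (nhds (1 - w * ((0 : ℝ) : ℂ))) :=
    tendsto_const_nhds.sub (tendsto_const_nhds.mul
      ((Complex.continuous_ofReal.tendsto _).comp tendsto_inv_atTop_zero))
  rw [Complex.ofReal_zero, mul_zero, sub_zero] at h1
  have h2 := (Complex.continuousAt_arg (Complex.one_mem_slitPlane)).tendsto.comp h1
  rw [Complex.arg_one] at h2
  have h3 := (tendsto_const_nhds (x := α)).add h2
  rw [add_zero] at h3
  refine h3.congr' ?_
  filter_upwards [Filter.eventually_gt_atTop 0] with r hr
  have hr' : (r : ℂ) ≠ 0 := by exact_mod_cast hr.ne'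
  have : (r : ℂ) - w = r * (1 - w * ((r⁻¹ : ℝ) : ℂ)) := by
    push_cast; field_simp
  rw [rayArg, ← hw, this, Complex.arg_real_mul _ hr]
  rfl

theorem Multiset.prod_mul_exp_sub (α r : ℝ) (s : Multiset ℂ) :
    ∃ c : ℝ, (s.map fun z => r * Complex.exp (α * Complex.I) - z).prod =
      c * Complex.exp (((s.map fun z => rayArg α z r).sum : ℝ) * Complex.I) := by
  induction s using Multiset.induction_on with
  | empty => exact ⟨1, by simp⟩
  | cons z s ih =>
    obtain ⟨c, hc⟩ := ih
    refine ⟨‖(r : ℂ) - z * Complex.exp (-(α * Complex.I))‖ * c, ?_⟩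
    rw [Multiset.map_cons, Multiset.prod_cons, hc, mul_exp_sub_eq_norm_mul_exp_rayArg,
      Multiset.map_cons, Multiset.sum_cons]
    push_cast
    rw [add_mul, Complex.exp_add]
    ring

theorem continuousOn_sum_rayArg {α : ℝ} (hα : α ∈ Set.Ioo 0 (Real.pi / 2)) (s : Multiset ℂ)
    (hs : ∀ z ∈ s, z ≠ 0 → |Complex.arg z| ≠ α) :
    ContinuousOn (fun r => (s.map fun z => rayArg α z r).sum) (Set.Ici 0) := by
  induction s using Multiset.induction_on with
  | empty => simpa using continuousOn_const
  | cons z s ih =>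
    simp only [Multiset.map_cons, Multiset.sum_cons]
    exact (continuousOn_rayArg hα (hs z (Multiset.mem_cons_self z s))).add
      (ih fun w hw => hs w (Multiset.mem_cons_of_mem hw))

theorem tendsto_sum_rayArg_atTop (α : ℝ) (s : Multiset ℂ) :
    Filter.Tendsto (fun r => (s.map fun z => rayArg α z r).sum) Filter.atTop
      (nhds (s.card * α)) := by
  induction s using Multiset.induction_on with
  | empty => simp
  | cons z s ih =>
    simp only [Multiset.map_cons, Multiset.sum_cons, Multiset.card_cons]
    convert (tendsto_rayArg_atTop α z).add ih using 2
    push_cast; ring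

theorem card_filter_mul_pi_le_sum_rayArg_zero {α : ℝ} (hα : α ∈ Set.Ioo 0 (Real.pi / 2))
    (s : Multiset ℂ) (hs : ∀ z ∈ s, z ≠ 0 → |Complex.arg z| ≠ α)
    (hconj : s.map (starRingEnd ℂ) = s) :
    (s.filter fun z => z ≠ 0 ∧ |Complex.arg z| ≤ α).card * Real.pi ≤
      (s.map fun z => rayArg α z 0).sum := by
  have h1 : (s.map fun z => rayArg α (starRingEnd ℂ z) 0).sum =
      (s.map fun z => rayArg α z 0).sum := by
    conv_rhs => rw [← hconj, Multiset.map_map]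
    rfl
  have h2 : 2 * ((s.filter fun z => z ≠ 0 ∧ |Complex.arg z| ≤ α).card * Real.pi) ≤
      (s.map fun z => rayArg α z 0 + rayArg α (starRingEnd ℂ z) 0).sum := by
    clear hconj h1
    induction s using Multiset.induction_on with
    | empty => simp
    | cons z s ih =>
      have hz := rayArg_zero_add_conj hα (hs z (Multiset.mem_cons_self z s))
      have ih := ih fun w hw => hs w (Multiset.mem_cons_of_mem hw)
      rw [Multiset.map_cons, Multiset.sum_cons, Multiset.filter_cons, Multiset.card_add]
      split_ifs at hz ⊢
      · simp only [Multiset.card_singleton]; push_cast; linarith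
      · simp only [Multiset.card_zero]; push_cast; linarith
  rw [Multiset.sum_map_add, h1] at h2
  linarith

open Polynomial in
theorem Polynomial.map_conj_roots_map_ofReal (P : ℝ[X]) :
    (P.map (algebraMap ℝ ℂ)).roots.map (starRingEnd ℂ) = (P.map (algebraMap ℝ ℂ)).roots := by
  rw [← Splits.roots_map (IsAlgClosed.splits _) (starRingEnd ℂ), Polynomial.map_map]
  congr 2
  ext x
  simp

/-- The polynomial `Im (exp (iε) * P (X * exp (iα)))`. -/
noncomputable def Polynomial.rotateIm (P : Polynomial ℝ) (α ε : ℝ) : Polynomial ℝ :=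
  ∑ k ∈ Finset.range (P.natDegree + 1),
    Polynomial.monomial k (P.coeff k * Real.sin (k * α + ε))

theorem Polynomial.coeff_rotateIm (P : Polynomial ℝ) (α ε : ℝ) (k : ℕ) :
    (P.rotateIm α ε).coeff k = P.coeff k * Real.sin (k * α + ε) := by
  simp only [rotateIm, finsetSum_coeff, coeff_monomial, Finset.sum_ite_eq', Finset.mem_range]
  split_ifs with h
  · rfl
  · rw [coeff_eq_zero_of_natDegree_lt (by lia), zero_mul]

theorem Polynomial.eval_rotateIm (P : Polynomial ℝ) (α ε r : ℝ) :
    (P.rotateIm α ε).eval r = (Complex.exp (ε * Complex.I) *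
      (P.map (algebraMap ℝ ℂ)).eval (r * Complex.exp (α * Complex.I))).im := by
  rw [rotateIm, eval_finsetSum, eval_eq_sum_range, natDegree_map, Finset.mul_sum,
    Complex.im_sum]
  refine Finset.sum_congr rfl fun k _ => ?_
  have : Complex.exp (ε * Complex.I) * ((P.map (algebraMap ℝ ℂ)).coeff k *
      (r * Complex.exp (α * Complex.I)) ^ k) =
      ((P.coeff k * r ^ k : ℝ) : ℂ) * Complex.exp ((k * α + ε : ℝ) * Complex.I) := by
    rw [mul_pow, ← Complex.exp_nat_mul, coeff_map]
    push_cast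
    rw [add_mul, Complex.exp_add]
    simp only [Complex.coe_algebraMap]
    rw [show (k : ℂ) * α * Complex.I = k * (α * Complex.I) by ring]
    ring
  rw [this, Complex.im_ofReal_mul, Complex.exp_ofReal_mul_I_im, eval_monomial]
  ring

theorem Polynomial.signVariations_rotateIm_le (P : Polynomial ℝ) (hcoeff : ∀ n, 0 ≤ P.coeff n)
    {α ε : ℝ} (hα : 0 ≤ α) (hε : 0 ≤ ε) {j : ℕ}
    (hj : P.natDegree * α + ε < (j + 1) * Real.pi) : (P.rotateIm α ε).signVariations ≤ j := by
  have hpos : ∀ k : ℕ, 0 ≤ k * α + ε := fun k => by positivity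
  refine signVariations_le_of_monotone_index _ (fun k => ⌊(k * α + ε) / Real.pi⌋₊) ?_ j ?_ ?_
  · intro k l hkl
    have : (k : ℝ) ≤ l := by exact_mod_cast hkl
    have hpi := Real.pi_pos
    dsimp only
    gcongr
  · intro k hk
    rw [coeff_rotateIm] at hk
    have hkd : (k : ℝ) ≤ P.natDegree := by
      exact_mod_cast le_natDegree_of_ne_zero (left_ne_zero_of_mul hk)
    refine Nat.lt_succ_iff.mp ((Nat.floor_lt (div_nonneg (hpos k) Real.pi_pos.le)).mpr ?_)
    rw [div_lt_iff₀ Real.pi_pos]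
    push_cast
    nlinarith
  · intro k l hk hl h
    rw [coeff_rotateIm] at hk hl ⊢
    rw [coeff_rotateIm]
    rw [sign_mul, sign_mul,
      sign_pos (lt_of_le_of_ne (hcoeff k) (left_ne_zero_of_mul hk).symm),
      sign_pos (lt_of_le_of_ne (hcoeff l) (left_ne_zero_of_mul hl).symm),
      Real.sign_sin_eq_of_floor_eq (hpos k) (hpos l) (right_ne_zero_of_mul hk)
        (right_ne_zero_of_mul hl) h]

/-- The sector bound when no root lies on the boundary of the sector. -/
theorem card_roots_sector_le_of_boundary (P : Polynomial ℝ) (hP : P ≠ 0)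
    (hcoeff : ∀ n, 0 ≤ P.coeff n) {α : ℝ} (hα : α ∈ Set.Ioo 0 (Real.pi / 2))
    (hb : ∀ z ∈ (P.map (algebraMap ℝ ℂ)).roots, z ≠ 0 → |Complex.arg z| ≠ α) :
    ((((P.map (algebraMap ℝ ℂ)).roots.filter
        (fun z => z ≠ 0 ∧ |Complex.arg z| ≤ α)).card : ℕ) : ℝ)
      ≤ 2 * α * P.natDegree / Real.pi := by
  have hpi := Real.pi_pos
  set s := (P.map (algebraMap ℝ ℂ)).roots with hs
  set N := (s.filter (fun z => z ≠ 0 ∧ |Complex.arg z| ≤ α)).card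
  have hstart := card_filter_mul_pi_le_sum_rayArg_zero hα s hb P.map_conj_roots_map_ofReal
  have hcont := continuousOn_sum_rayArg hα s hb
  have hend := tendsto_sum_rayArg_atTop α s
  have hcard : s.card = P.natDegree := IsAlgClosed.card_roots_map_eq_natDegree_of_injective _ (algebraMap ℝ ℂ).injective
  rw [hcard] at hend
  set φ : ℝ → ℝ := fun r => (s.map fun z => rayArg α z r).sum with hφ
  set d := P.natDegree with hd
  have hx : 0 ≤ d * α / Real.pi := by have := hα.1; positivity
  set j := ⌊d * α / Real.pi⌋₊ with hj
  have hj1 := Nat.floor_le hx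
  have hj2 := Nat.lt_floor_add_one (d * α / Real.pi)
  rw [← hj] at hj1 hj2
  have hj1' := (le_div_iff₀ hpi).mp hj1
  have hj2' := (div_lt_iff₀ hpi).mp hj2
  set ε : ℝ := ((j + 1) * Real.pi - d * α) / 2 with hε
  have hε0 : 0 < ε := by rw [hε]; linarith
  have hεlt : d * α + ε < (j + 1) * Real.pi := by rw [hε]; linarith
  set Q := P.rotateIm α ε with hQ
  have hQ0 : Q ≠ 0 := by
    intro h
    have h1 : Q.coeff d = 0 := by rw [h, Polynomial.coeff_zero]
    rw [hQ, Polynomial.coeff_rotateIm] at h1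
    rcases mul_eq_zero.mp h1 with h1 | h1
    · exact hP (Polynomial.leadingCoeff_eq_zero.mp h1)
    · have h2 : Real.sin (d * α + ε - j * Real.pi) ≠ 0 :=
        (Real.sin_pos_of_pos_of_lt_pi (by linarith) (by linarith)).ne'
      rw [Real.sin_sub_nat_mul_pi, h1, mul_zero] at h2
      exact h2 rfl
  have hroot : ∀ m ∈ Finset.Icc (j + 1) N, ∃ r : ℝ, 0 < r ∧ φ r = m * Real.pi - ε := by
    intro m hm
    rw [Finset.mem_Icc] at hm
    have hm1 : (j : ℝ) + 1 ≤ m := by exact_mod_cast hm.1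
    have hm2 : (m : ℝ) ≤ N := by exact_mod_cast hm.2
    have hlow : d * α < m * Real.pi - ε := by nlinarith
    have hhigh : m * Real.pi - ε < φ 0 := by
      have : m * Real.pi ≤ N * Real.pi := by gcongr
      linarith
    obtain ⟨R, hR, hR0⟩ :=
      ((hend.eventually (gt_mem_nhds hlow)).and (Filter.eventually_gt_atTop 0)).exists
    obtain ⟨r, hr, hr'⟩ := intermediate_value_Icc' hR0.le
      (hcont.mono Set.Icc_subset_Ici_self) ⟨hR.le, hhigh.le⟩
    refine ⟨r, lt_of_le_of_ne hr.1 fun h => ?_, hr'⟩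
    rw [← h] at hr'
    exact hhigh.ne' hr'
  choose! r hr hr' using hroot
  have hinj : Set.InjOn r (Finset.Icc (j + 1) N) := by
    intro m hm n hn hmn
    have h1 := hr' m hm
    rw [hmn, hr' n hn] at h1
    have h2 : (n : ℝ) = m := mul_right_cancel₀ hpi.ne' (by linarith)
    exact_mod_cast h2.symm
  have hev : ∀ m ∈ Finset.Icc (j + 1) N, Q.eval (r m) = 0 := by
    intro m hm
    obtain ⟨c, hc⟩ := Multiset.prod_mul_exp_sub α (r m) s
    rw [hQ, Polynomial.eval_rotateIm,
      (IsAlgClosed.splits (P.map (algebraMap ℝ ℂ))).eval_eq_prod_roots, ← hs, hc]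
    have hsum : (s.map fun z => rayArg α z (r m)).sum = m * Real.pi - ε := hr' m hm
    rw [hsum, Polynomial.leadingCoeff_map]
    have : Complex.exp (ε * Complex.I) * ((algebraMap ℝ ℂ) P.leadingCoeff *
        (c * Complex.exp ((m * Real.pi - ε : ℝ) * Complex.I))) =
        ((P.leadingCoeff * c : ℝ) : ℂ) * Complex.exp ((m * Real.pi : ℝ) * Complex.I) := by
      rw [show ((m * Real.pi : ℝ) : ℂ) * Complex.I =
        ε * Complex.I + ((m * Real.pi - ε : ℝ) : ℂ) * Complex.I by push_cast; ring,
        Complex.exp_add]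
      simp only [Complex.coe_algebraMap]
      push_cast
      ring
    rw [this, Complex.im_ofReal_mul, Complex.exp_ofReal_mul_I_im, Real.sin_nat_mul_pi, mul_zero]
  have hcount : N - j ≤ j := by
    calc N - j = ((Finset.Icc (j + 1) N).image r).card := by
          rw [Finset.card_image_of_injOn hinj, Nat.card_Icc]; lia
      _ ≤ (Q.roots.filter (0 < ·)).card := by
          refine Multiset.card_le_card (Finset.val_le_iff_val_subset.mpr fun x hx => ?_)
          obtain ⟨m, hm, rfl⟩ := Finset.mem_image.mp (Finset.mem_val.mp hx)
          rw [Multiset.mem_filter, Polynomial.mem_roots hQ0]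
          exact ⟨hev m hm, hr m hm⟩
      _ = Q.roots.countP (0 < ·) := (Multiset.countP_eq_card_filter _ _).symm
      _ ≤ Q.signVariations := by
          convert Polynomial.roots_countP_pos_le_signVariations Q
      _ ≤ j := P.signVariations_rotateIm_le hcoeff hα.1.le hε0.le hεlt
  have hN : (N : ℝ) ≤ 2 * j := by exact_mod_cast (by lia : N ≤ 2 * j)
  calc (N : ℝ) ≤ 2 * (d * α / Real.pi) := by linarith
    _ = 2 * α * d / Real.pi := by ring

theorem stmt2 (P : Polynomial ℝ) (d : ℕ) (hd : 1 ≤ d) (hdeg : P.natDegree = d)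
    (hcoeff : ∀ n, 0 ≤ P.coeff n)
    (α : ℝ) (hα : α ∈ Set.Ioo 0 (Real.pi / 2)) :
    ((((P.map (algebraMap ℝ ℂ)).roots.filter
        (fun z => z ≠ 0 ∧ |Complex.arg z| ≤ α)).card : ℕ) : ℝ)
      ≤ 2 * α * d / Real.pi := by
  have hpi := Real.pi_pos
  have hP : P ≠ 0 := by
    rintro rfl
    simp at hdeg
    lia
  have hbad : Set.Finite {x : ℝ | ∃ z ∈ (P.map (algebraMap ℝ ℂ)).roots, |Complex.arg z| = x} := by
    refine ((P.map (algebraMap ℝ ℂ)).roots.toFinset.image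
      fun z => |Complex.arg z|).finite_toSet.subset ?_
    rintro x ⟨z, hz, rfl⟩
    simpa using ⟨z, by simpa using hz, rfl⟩
  rw [le_div_iff₀ hpi]
  have hd0 : (0 : ℝ) < d := by exact_mod_cast hd
  refine le_of_forall_pos_le_add fun δ hδ => ?_
  have hlt : α < min (α + δ / (2 * d)) (Real.pi / 2) :=
    lt_min (lt_add_of_pos_right _ (by positivity)) hα.2
  obtain ⟨β, ⟨hαβ, hβ⟩, hβbad⟩ := (Set.Ioo_infinite hlt).exists_notMem_finite hbad
  rw [lt_min_iff] at hβ
  have hmain := card_roots_sector_le_of_boundary P hP hcoeff ⟨hα.1.trans hαβ, hβ.2⟩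
    fun z hz _ h => hβbad ⟨z, hz, h⟩
  rw [hdeg, le_div_iff₀ hpi] at hmain
  have hmono : (((P.map (algebraMap ℝ ℂ)).roots.filter
      (fun z => z ≠ 0 ∧ |Complex.arg z| ≤ α)).card : ℝ) ≤
      ((P.map (algebraMap ℝ ℂ)).roots.filter (fun z => z ≠ 0 ∧ |Complex.arg z| ≤ β)).card := by
    exact_mod_cast Multiset.card_le_card
      (Multiset.monotone_filter_right (P.map (algebraMap ℝ ℂ)).roots
        (p := fun z => z ≠ 0 ∧ |Complex.arg z| ≤ α) (q := fun z => z ≠ 0 ∧ |Complex.arg z| ≤ β)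
        fun z hz => ⟨hz.1, hz.2.trans hαβ.le⟩)
  have hβd : 2 * β * d ≤ 2 * α * d + δ := by
    calc 2 * β * d ≤ 2 * (α + δ / (2 * d)) * d := by gcongr; exact hβ.1.le
      _ = 2 * α * d + δ := by field_simp
  exact ((mul_le_mul_of_nonneg_right hmono hpi.le).trans hmain).trans hβd
end

section
/- Let P be a polynomial with real nonnegative coefficients of degree d ≥ 1. For t ∈ [0, π] let n(t) denote the number of roots of P, counted with multiplicity, lying in the sector {z ∈ ℂ, z ≠ 0 : |Arg z| ≤ t}. Then for every a ∈ (0, π], (1/a) · ∫₀^a n(t) dt ≤ a·d/(2π). -/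
open scoped Classical

open MeasureTheory in
theorem integral_exp_neg_mul_abs {b : ℝ} (hb : 0 < b) :
    ∫ x : ℝ, Real.exp (-b * |x|) = 2 / b := by
  rw [integral_comp_abs (f := fun x => Real.exp (-b * x)),
    integral_exp_mul_Ioi (by linarith) 0]
  simp [div_eq_mul_inv]

open MeasureTheory in
theorem integrable_exp_neg_mul_abs {b : ℝ} (hb : 0 < b) :
    Integrable fun x : ℝ => Real.exp (-b * |x|) := by
  refine Integrable.of_integral_ne_zero ?_
  rw [integral_exp_neg_mul_abs hb]
  positivity

open MeasureTheory in
theorem integrable_exp_neg_nat_mul_abs_div (n : ℕ) :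
    Integrable fun x : ℝ => Real.exp (-n * |x|) / n := by
  rcases n.eq_zero_or_pos with rfl | hn
  · simp
  · exact (integrable_exp_neg_mul_abs (Nat.cast_pos.2 hn)).div_const _

open MeasureTheory in
theorem integral_exp_neg_nat_mul_abs_div (n : ℕ) :
    ∫ x : ℝ, Real.exp (-n * |x|) / n = 2 * (1 / (n : ℝ) ^ 2) := by
  rcases n.eq_zero_or_pos with rfl | hn
  · simp
  · rw [integral_div, integral_exp_neg_mul_abs (Nat.cast_pos.2 hn)]
    field_simp

open MeasureTheory in
theorem integrable_tsum_exp_neg_nat_mul_abs_div :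
    Integrable fun x : ℝ => ∑' n : ℕ, Real.exp (-n * |x|) / n := by
  have hs : HasSum (fun n : ℕ => 2 * (1 / (n : ℝ) ^ 2)) (2 * (Real.pi ^ 2 / 6)) :=
    hasSum_zeta_two.mul_left 2
  have h := hasSum_integral_of_summable_integral_norm integrable_exp_neg_nat_mul_abs_div (by
    convert hs.summable using 2 with n
    rw [← integral_exp_neg_nat_mul_abs_div]
    congr 1 with x
    exact Real.norm_of_nonneg (by positivity))
  simp only [integral_exp_neg_nat_mul_abs_div] at h
  refine Integrable.of_integral_ne_zero ?_
  rw [h.unique hs]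
  positivity

theorem hasSum_exp_neg_nat_mul_abs_mul_cos_div (ψ : ℝ) {x : ℝ} (hx : x ≠ 0) :
    HasSum (fun n : ℕ => Real.exp (-n * |x|) / n * Real.cos (n * ψ))
      (-Real.log ‖1 - Real.exp (-|x|) * Complex.exp (ψ * Complex.I)‖) := by
  have hz : ‖(Real.exp (-|x|) * Complex.exp (ψ * Complex.I) : ℂ)‖ < 1 := by
    rw [norm_mul, Complex.norm_exp_ofReal_mul_I, mul_one, Complex.norm_real, Real.norm_eq_abs,
      Real.abs_exp, Real.exp_lt_one_iff]
    simpa using hx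
  have h := Complex.hasSum_re (Complex.hasSum_taylorSeries_neg_log hz)
  rw [Complex.neg_re, Complex.log_re] at h
  convert h using 2 with n
  have h1 : (Real.exp (-|x|) * Complex.exp (ψ * Complex.I) : ℂ) ^ n / n =
      ((Real.exp (-n * |x|) / n : ℝ) : ℂ) * Complex.exp ((n * ψ : ℝ) * Complex.I) := by
    rw [mul_pow, ← Complex.exp_nat_mul, ← Complex.ofReal_pow, ← Real.exp_nat_mul]
    push_cast
    ring_nf
  rw [h1, Complex.re_ofReal_mul, Complex.exp_ofReal_mul_I_re]

theorem hasSum_cos_div_sq {ψ : ℝ} (h0 : 0 ≤ ψ) (h1 : ψ ≤ 2 * Real.pi) :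
    HasSum (fun n : ℕ => 2 * (1 / (n : ℝ) ^ 2) * Real.cos (n * ψ))
      ((Real.pi - ψ) ^ 2 / 2 - Real.pi ^ 2 / 6) := by
  have hpi := Real.pi_pos
  have h := (hasSum_one_div_nat_pow_mul_cos (k := 1) one_ne_zero (x := ψ / (2 * Real.pi))
    ⟨by positivity, by rw [div_le_one (by positivity)]; exact h1⟩).mul_left 2
  have e1 : (fun n : ℕ => 2 * (1 / (n : ℝ) ^ (2 * 1) *
      Real.cos (2 * Real.pi * n * (ψ / (2 * Real.pi))))) =
      fun n : ℕ => 2 * (1 / (n : ℝ) ^ 2) * Real.cos (n * ψ) := by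
    ext n
    rw [← mul_assoc, show 2 * Real.pi * n * (ψ / (2 * Real.pi)) = n * ψ by field_simp]
  rw [e1] at h
  convert! h using 1
  simp [Polynomial.bernoulli, Finset.sum_range_succ, bernoulli_two, Polynomial.eval_add]
  field_simp
  ring

open MeasureTheory in
/-- The logarithmic potential of a root on the positive real axis, along the ray of argument `ψ`
and in the logarithmic variable, normalised so as to be integrable. -/
theorem integrable_log_norm_one_sub (ψ : ℝ) :
    Integrable fun x : ℝ => Real.log ‖1 - Real.exp (-|x|) * Complex.exp (ψ * Complex.I)‖ := by
  have h0 : ∀ᵐ x : ℝ, x ≠ 0 := by simp [ae_iff]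
  refine integrable_tsum_exp_neg_nat_mul_abs_div.mono'
    (Measurable.aestronglyMeasurable (by fun_prop)) ?_
  filter_upwards [h0] with x hx
  have hb : Summable fun n : ℕ => Real.exp (-n * |x|) / n := by
    simpa using (hasSum_exp_neg_nat_mul_abs_mul_cos_div 0 hx).summable
  rw [← norm_neg]
  refine (hasSum_exp_neg_nat_mul_abs_mul_cos_div ψ hx).norm_le_of_bounded hb.hasSum fun n => ?_
  rw [norm_mul, Real.norm_of_nonneg (by positivity)]
  exact mul_le_of_le_one_right (by positivity) (Real.abs_cos_le_one _)

open MeasureTheory in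
theorem hasSum_integral_log_norm_one_sub (ψ : ℝ) :
    HasSum (fun n : ℕ => 2 * (1 / (n : ℝ) ^ 2) * Real.cos (n * ψ))
      (-∫ x : ℝ, Real.log ‖1 - Real.exp (-|x|) * Complex.exp (ψ * Complex.I)‖) := by
  have h0 : ∀ᵐ x : ℝ, x ≠ 0 := by simp [ae_iff]
  have h := hasSum_integral_of_dominated_convergence (μ := (volume : Measure ℝ))
    (F := fun (n : ℕ) x => Real.exp (-n * |x|) / n * Real.cos (n * ψ))
    (f := fun x => -Real.log ‖1 - Real.exp (-|x|) * Complex.exp (ψ * Complex.I)‖)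
    (fun (n : ℕ) x => Real.exp (-n * |x|) / n) (fun n => by fun_prop)
    (fun n => Filter.Eventually.of_forall fun x => by
      rw [norm_mul, Real.norm_of_nonneg (by positivity)]
      exact mul_le_of_le_one_right (by positivity) (Real.abs_cos_le_one _))
    (by
      filter_upwards [h0] with x hx
      simpa using (hasSum_exp_neg_nat_mul_abs_mul_cos_div 0 hx).summable)
    integrable_tsum_exp_neg_nat_mul_abs_div
    (by
      filter_upwards [h0] with x hx
      exact hasSum_exp_neg_nat_mul_abs_mul_cos_div ψ hx)
  simpa only [integral_mul_const, integral_exp_neg_nat_mul_abs_div, integral_neg] using h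

theorem integral_log_norm_one_sub {ψ : ℝ} (h0 : 0 ≤ ψ) (h1 : ψ ≤ 2 * Real.pi) :
    ∫ x : ℝ, Real.log ‖1 - Real.exp (-|x|) * Complex.exp (ψ * Complex.I)‖ =
      Real.pi ^ 2 / 6 - (Real.pi - ψ) ^ 2 / 2 := by
  linarith [(hasSum_integral_log_norm_one_sub ψ).unique (hasSum_cos_div_sq h0 h1)]

theorem integral_log_norm_one_sub_abs (ψ : ℝ) :
    ∫ x : ℝ, Real.log ‖1 - Real.exp (-|x|) * Complex.exp ((|ψ| : ℝ) * Complex.I)‖ =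
      ∫ x : ℝ, Real.log ‖1 - Real.exp (-|x|) * Complex.exp (ψ * Complex.I)‖ := by
  have h : ∀ n : ℕ, Real.cos (n * |ψ|) = Real.cos (n * ψ) := fun n => by
    rw [← Real.cos_abs (n * ψ), abs_mul, Nat.abs_cast]
  have h1 := hasSum_integral_log_norm_one_sub |ψ|
  simp only [h] at h1
  linarith [h1.unique (hasSum_integral_log_norm_one_sub ψ)]

theorem log_norm_exp_mul_sub_one (ψ : ℝ) {y : ℝ} (hy : y ≠ 0) :
    Real.log ‖(Real.exp y * Complex.exp (ψ * Complex.I) - 1 : ℂ)‖ =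
      max 0 y + Real.log ‖1 - Real.exp (-|y|) * Complex.exp (ψ * Complex.I)‖ := by
  rcases lt_or_gt_of_ne hy with h | h
  · rw [max_eq_left h.le, abs_of_neg h, neg_neg, zero_add, norm_sub_rev]
  · rw [max_eq_right h.le, abs_of_pos h]
    have e1 : (Real.exp y * Complex.exp (ψ * Complex.I) - 1 : ℂ) =
        (Real.exp y * Complex.exp (ψ * Complex.I)) *
          (starRingEnd ℂ) (1 - Real.exp (-y) * Complex.exp (ψ * Complex.I)) := by
      rw [map_sub, map_mul, map_one, Complex.conj_ofReal, ← Complex.exp_conj, map_mul,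
        Complex.conj_ofReal, Complex.conj_I, mul_sub, mul_one]
      push_cast
      rw [← Complex.exp_add, ← Complex.exp_add, ← Complex.exp_add]
      ring_nf
      rw [Complex.exp_zero]
      ring
    have hne : (1 - Real.exp (-y) * Complex.exp (ψ * Complex.I) : ℂ) ≠ 0 := by
      intro h2
      have h3 := congrArg norm (sub_eq_zero.1 h2)
      rw [norm_mul, Complex.norm_exp_ofReal_mul_I, mul_one, Complex.norm_real, Real.norm_eq_abs,
        Real.abs_exp, norm_one, eq_comm, Real.exp_eq_one_iff] at h3
      linarith
    rw [e1, norm_mul, norm_mul, Complex.norm_conj, Complex.norm_exp_ofReal_mul_I, mul_one,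
      Complex.norm_real, Real.norm_eq_abs, Real.abs_exp,
      Real.log_mul (Real.exp_ne_zero _) (norm_ne_zero_iff.2 hne), Real.log_exp]

theorem exp_mul_exp_sub_ne_zero (ψ : ℝ) {x : ℝ} {z : ℂ} (hx : x ≠ Real.log ‖z‖) :
    (Real.exp x * Complex.exp (ψ * Complex.I) - z : ℂ) ≠ 0 := by
  intro h
  apply hx
  rw [← sub_eq_zero.1 h, norm_mul, Complex.norm_exp_ofReal_mul_I, mul_one, Complex.norm_real,
    Real.norm_eq_abs, Real.abs_exp, Real.log_exp]

theorem log_norm_exp_mul_sub (ψ : ℝ) {x : ℝ} {z : ℂ} (hz : z ≠ 0) (hx : x ≠ Real.log ‖z‖) :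
    Real.log ‖(Real.exp x * Complex.exp (ψ * Complex.I) - z : ℂ)‖ =
      Real.log ‖z‖ + (max 0 (x - Real.log ‖z‖) +
        Real.log ‖1 - Real.exp (-|x - Real.log ‖z‖|) *
          Complex.exp ((ψ - z.arg : ℝ) * Complex.I)‖) := by
  rw [← log_norm_exp_mul_sub_one _ (sub_ne_zero.2 hx), ← Real.log_mul, ← norm_mul]
  · congr 2
    have h1 : z * (Real.exp (x - Real.log ‖z‖) * Complex.exp ((ψ - z.arg : ℝ) * Complex.I)) =
        Real.exp x * Complex.exp (ψ * Complex.I) := by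
      nth_rewrite 1 [← Complex.norm_mul_exp_arg_mul_I z]
      rw [Real.exp_sub, Real.exp_log (norm_pos_iff.2 hz)]
      have : (‖z‖ : ℂ) ≠ 0 := by simpa using hz
      push_cast
      rw [sub_mul, Complex.exp_sub]
      field_simp
    rw [mul_sub, h1, mul_one]
  · exact norm_ne_zero_iff.2 hz
  · exact norm_ne_zero_iff.2 (exp_mul_exp_sub_ne_zero (z := 1) (ψ - z.arg)
      (by simpa [sub_eq_zero] using hx))

open MeasureTheory in
theorem integrable_and_integral_multiset_sum {α ι : Type*} [MeasurableSpace α] {μ : Measure α}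
    (s : Multiset ι) (f : ι → α → ℝ) (hf : ∀ i ∈ s, Integrable (f i) μ) :
    Integrable (fun x => (s.map fun i => f i x).sum) μ ∧
      ∫ x, (s.map fun i => f i x).sum ∂μ = (s.map fun i => ∫ x, f i x ∂μ).sum := by
  induction s using Multiset.induction_on with
  | empty => simp
  | cons i s ih =>
    obtain ⟨h1, h2⟩ := ih fun j hj => hf j (Multiset.mem_cons_of_mem hj)
    have hi := hf i (Multiset.mem_cons_self i s)
    simp only [Multiset.map_cons, Multiset.sum_cons]
    exact ⟨hi.add h1, by rw [integral_add hi h1, h2]⟩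

open MeasureTheory in
theorem ae_log_norm_sub_log_norm_eq (ψ : ℝ) {z : ℂ} (hz : z ≠ 0) :
    (fun x : ℝ => Real.log ‖(Real.exp x - z : ℂ)‖ -
        Real.log ‖(Real.exp x * Complex.exp (ψ * Complex.I) - z : ℂ)‖) =ᵐ[volume]
      fun x => Real.log ‖1 - Real.exp (-|x - Real.log ‖z‖|) *
          Complex.exp ((-z.arg : ℝ) * Complex.I)‖ -
        Real.log ‖1 - Real.exp (-|x - Real.log ‖z‖|) *
          Complex.exp ((ψ - z.arg : ℝ) * Complex.I)‖ := by
  have h0 : ∀ᵐ x : ℝ, x ≠ Real.log ‖z‖ := by simp [ae_iff]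
  filter_upwards [h0] with x hx
  have h1 := log_norm_exp_mul_sub 0 hz hx
  rw [zero_sub, Complex.ofReal_zero, zero_mul, Complex.exp_zero, mul_one] at h1
  rw [h1, log_norm_exp_mul_sub ψ hz hx]
  ring

open MeasureTheory in
theorem integrable_log_norm_sub_log_norm (ψ : ℝ) (z : ℂ) :
    Integrable fun x : ℝ => Real.log ‖(Real.exp x - z : ℂ)‖ -
        Real.log ‖(Real.exp x * Complex.exp (ψ * Complex.I) - z : ℂ)‖ := by
  rcases eq_or_ne z 0 with rfl | hz
  · simp [Complex.norm_exp]
  · exact (((integrable_log_norm_one_sub _).comp_sub_right _).sub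
      ((integrable_log_norm_one_sub _).comp_sub_right _)).congr
        (ae_log_norm_sub_log_norm_eq ψ hz).symm

open MeasureTheory in
theorem integral_log_norm_sub_log_norm (ψ : ℝ) {z : ℂ} (hz : z ≠ 0) :
    ∫ x : ℝ, (Real.log ‖(Real.exp x - z : ℂ)‖ -
        Real.log ‖(Real.exp x * Complex.exp (ψ * Complex.I) - z : ℂ)‖) =
      (∫ x : ℝ, Real.log ‖1 - Real.exp (-|x|) * Complex.exp ((-z.arg : ℝ) * Complex.I)‖) -
        ∫ x : ℝ, Real.log ‖1 - Real.exp (-|x|) *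
          Complex.exp ((ψ - z.arg : ℝ) * Complex.I)‖ := by
  rw [integral_congr_ae (ae_log_norm_sub_log_norm_eq ψ hz), integral_sub
    ((integrable_log_norm_one_sub _).comp_sub_right _)
    ((integrable_log_norm_one_sub _).comp_sub_right _)]
  congr 1
  · exact integral_sub_right_eq_self
      (fun x => Real.log ‖1 - Real.exp (-|x|) * Complex.exp ((-z.arg : ℝ) * Complex.I)‖) _
  · exact integral_sub_right_eq_self
      (fun x => Real.log ‖1 - Real.exp (-|x|) * Complex.exp ((ψ - z.arg : ℝ) * Complex.I)‖) _

theorem integral_log_norm_sub_log_norm_add_neg {a : ℝ} (h0 : 0 ≤ a) (h1 : a ≤ Real.pi) {z : ℂ}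
    (hz : z ≠ 0) :
    (∫ x : ℝ, (Real.log ‖(Real.exp x - z : ℂ)‖ -
        Real.log ‖(Real.exp x * Complex.exp (a * Complex.I) - z : ℂ)‖)) +
      (∫ x : ℝ, (Real.log ‖(Real.exp x - z : ℂ)‖ -
        Real.log ‖(Real.exp x * Complex.exp ((-a : ℝ) * Complex.I) - z : ℂ)‖)) =
      a ^ 2 - 2 * Real.pi * max 0 (a - |z.arg|) := by
  rw [integral_log_norm_sub_log_norm _ hz, integral_log_norm_sub_log_norm _ hz,
    ← integral_log_norm_one_sub_abs (-z.arg), ← integral_log_norm_one_sub_abs (a - z.arg),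
    ← integral_log_norm_one_sub_abs (-a - z.arg)]
  have hpi := Real.pi_pos
  have hle := Complex.abs_arg_le_pi z
  have b1 : |a - z.arg| ≤ 2 * Real.pi := (abs_sub _ _).trans (by rw [abs_of_nonneg h0]; linarith)
  have b2 : |-a - z.arg| ≤ 2 * Real.pi :=
    (abs_sub _ _).trans (by rw [abs_neg, abs_of_nonneg h0]; linarith)
  rw [integral_log_norm_one_sub (abs_nonneg _) (by rw [abs_neg]; linarith),
    integral_log_norm_one_sub (abs_nonneg _) b1, integral_log_norm_one_sub (abs_nonneg _) b2]
  rw [abs_neg]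
  have hm : a ^ 2 - 2 * Real.pi * max 0 (a - |z.arg|) =
      (Real.pi - |(a - |z.arg|)|) ^ 2 / 2 + (Real.pi - (a + |z.arg|)) ^ 2 / 2 -
        (Real.pi - |z.arg|) ^ 2 := by
    rcases le_total a |z.arg| with h | h
    · rw [max_eq_left (by linarith), abs_of_nonpos (show a - |z.arg| ≤ 0 by linarith)]
      ring
    · rw [max_eq_right (by linarith), abs_of_nonneg (show 0 ≤ a - |z.arg| by linarith)]
      ring
  rw [hm]
  rcases le_total 0 z.arg with h | h
  · rw [abs_of_nonpos (show -a - z.arg ≤ 0 by linarith), abs_of_nonneg h]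
    ring
  · rw [abs_of_nonneg (show 0 ≤ a - z.arg by linarith), abs_of_nonpos h,
      ← abs_neg (-a - z.arg)]
    ring_nf

theorem norm_eval_map_exp_le {P : Polynomial ℝ} (hcoeff : ∀ n, 0 ≤ P.coeff n) (x ψ : ℝ) :
    ‖(P.map (algebraMap ℝ ℂ)).eval (Real.exp x * Complex.exp (ψ * Complex.I))‖ ≤
      ‖(P.map (algebraMap ℝ ℂ)).eval (Real.exp x : ℂ)‖ := by
  have h : (P.map (algebraMap ℝ ℂ)).eval (Real.exp x : ℂ) = ((P.eval (Real.exp x) : ℝ) : ℂ) := by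
    rw [Polynomial.eval_map_algebraMap]
    exact Polynomial.aeval_algebraMap_apply ℂ (Real.exp x) P
  have h2 : 0 ≤ P.eval (Real.exp x) := by
    rw [Polynomial.eval_eq_sum_range]
    exact Finset.sum_nonneg fun i _ => mul_nonneg (hcoeff i) (by positivity)
  rw [h, Complex.norm_real, Real.norm_of_nonneg h2, Polynomial.eval_eq_sum_range,
    Polynomial.natDegree_map, Polynomial.eval_eq_sum_range]
  refine (norm_sum_le _ _).trans (Finset.sum_le_sum fun i _ => ?_)
  rw [norm_mul, norm_pow, norm_mul, Complex.norm_exp_ofReal_mul_I, Polynomial.coeff_map]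
  simp [abs_of_nonneg (hcoeff i), Complex.norm_exp]

theorem log_norm_multiset_prod (s : Multiset ℂ) (w : ℂ) (h : ∀ z ∈ s, w - z ≠ 0) :
    Real.log ‖(s.map fun z => w - z).prod‖ = (s.map fun z => Real.log ‖w - z‖).sum := by
  induction s using Multiset.induction_on with
  | empty => simp
  | cons z s ih =>
    have hs : ∀ y ∈ s, w - y ≠ 0 := fun y hy => h y (Multiset.mem_cons_of_mem hy)
    have hne : (s.map fun z => w - z).prod ≠ 0 := Multiset.prod_ne_zero fun h0 => by
      obtain ⟨y, hy, h1⟩ := Multiset.mem_map.1 h0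
      exact hs y hy h1
    simp only [Multiset.map_cons, Multiset.prod_cons, Multiset.sum_cons]
    rw [norm_mul, Real.log_mul (norm_ne_zero_iff.2 (h z (Multiset.mem_cons_self z s)))
      (norm_ne_zero_iff.2 hne), ih hs]

open MeasureTheory in
theorem zero_le_sum_integral_log_norm_sub {P : Polynomial ℝ} (hP : P ≠ 0)
    (hcoeff : ∀ n, 0 ≤ P.coeff n) (ψ : ℝ) :
    0 ≤ ((P.map (algebraMap ℝ ℂ)).roots.map fun z =>
      ∫ x : ℝ, (Real.log ‖(Real.exp x - z : ℂ)‖ -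
        Real.log ‖(Real.exp x * Complex.exp (ψ * Complex.I) - z : ℂ)‖)).sum := by
  rw [← (integrable_and_integral_multiset_sum _ _
    fun z _ => integrable_log_norm_sub_log_norm ψ z).2]
  refine integral_nonneg_of_ae ?_
  set Q := P.map (algebraMap ℝ ℂ) with hQ
  have hQ0 : Q ≠ 0 := (Polynomial.map_ne_zero_iff (algebraMap ℝ ℂ).injective).2 hP
  have h0 : ∀ᵐ x : ℝ, ∀ z ∈ Q.roots.toFinset, x ≠ Real.log ‖z‖ := by
    rw [Filter.eventually_all_finset]
    intro z _
    simp [ae_iff]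
  filter_upwards [h0] with x hx
  have hx' : ∀ z ∈ Q.roots, x ≠ Real.log ‖z‖ := fun z hz => hx z (Multiset.mem_toFinset.2 hz)
  have hne : ∀ z ∈ Q.roots, (Real.exp x * Complex.exp (ψ * Complex.I) - z : ℂ) ≠ 0 :=
    fun z hz => exp_mul_exp_sub_ne_zero ψ (hx' z hz)
  have hne0 : ∀ z ∈ Q.roots, (Real.exp x - z : ℂ) ≠ 0 := fun z hz => by
    simpa using exp_mul_exp_sub_ne_zero 0 (hx' z hz)
  rw [Multiset.sum_map_sub, ← log_norm_multiset_prod _ _ hne, ← log_norm_multiset_prod _ _ hne0,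
    Pi.zero_apply, sub_nonneg]
  refine Real.log_le_log (norm_pos_iff.2 (Multiset.prod_ne_zero fun h0 => ?_)) ?_
  · obtain ⟨z, hz, h1⟩ := Multiset.mem_map.1 h0
    exact hne z hz h1
  · have h := norm_eval_map_exp_le hcoeff x ψ
    rw [← hQ, (IsAlgClosed.splits Q).eval_eq_prod_roots, (IsAlgClosed.splits Q).eval_eq_prod_roots,
      norm_mul, norm_mul] at h
    exact le_of_mul_le_mul_left h (by simpa using hQ0)

open MeasureTheory in
theorem integral_indicator_le (a : ℝ) {c : ℝ} (hc : 0 ≤ c) :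
    IntegrableOn (fun t : ℝ => if c ≤ t then (1 : ℝ) else 0) (Set.Ioc 0 a) ∧
    ∫ t in Set.Ioc 0 a, (if c ≤ t then (1 : ℝ) else 0) = max 0 (a - c) := by
  have h : (fun t : ℝ => if c ≤ t then (1 : ℝ) else 0) = (Set.Ici c).indicator 1 := by
    ext t
    simp [Set.indicator_apply]
  rw [h]
  constructor
  · exact (integrable_const (1 : ℝ)).indicator measurableSet_Ici
  · rw [integral_indicator_one measurableSet_Ici, measureReal_restrict_apply measurableSet_Ici]
    have he : (Set.Ici c ∩ Set.Ioc 0 a : Set ℝ) =ᵐ[volume] Set.Ioc c a := by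
      have h1 : (Set.Ioc c a : Set ℝ) = Set.Ioi c ∩ Set.Ioc 0 a := by
        ext t
        simp only [Set.mem_Ioc, Set.mem_inter_iff, Set.mem_Ioi]
        exact ⟨fun h => ⟨h.1, hc.trans_lt h.1, h.2⟩, fun h => ⟨h.1, h.2.2⟩⟩
      rw [h1]
      exact Ioi_ae_eq_Ici.symm.inter (ae_eq_refl _)
    rw [measureReal_congr he, Real.volume_real_Ioc, max_comm]

theorem stmt3 (P : Polynomial ℝ) (d : ℕ) (hd : 1 ≤ d) (hdeg : P.natDegree = d)
    (hcoeff : ∀ n, 0 ≤ P.coeff n)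
    (a : ℝ) (ha : a ∈ Set.Ioc 0 Real.pi) :
    (1 / a) * (∫ t in (0:ℝ)..a,
        ((((P.map (algebraMap ℝ ℂ)).roots.filter
            (fun z => z ≠ 0 ∧ |Complex.arg z| ≤ t)).card : ℕ) : ℝ))
      ≤ a * d / (2 * Real.pi) := by
  have hP : P ≠ 0 := by rintro rfl; simp at hdeg; omega
  obtain ⟨ha0, hapi⟩ := ha
  have hpi := Real.pi_pos
  have hcard : (P.map (algebraMap ℝ ℂ)).roots.card = d := by
    rw [← hdeg, ← Polynomial.natDegree_map (algebraMap ℝ ℂ)]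
    exact (IsAlgClosed.splits _).natDegree_eq_card_roots.symm
  have hpos := add_nonneg (zero_le_sum_integral_log_norm_sub hP hcoeff a)
    (zero_le_sum_integral_log_norm_sub hP hcoeff (-a))
  rw [← Multiset.sum_map_add] at hpos
  set s := (P.map (algebraMap ℝ ℂ)).roots with hs
  have key : ∫ t in (0:ℝ)..a, (((s.filter (fun z => z ≠ 0 ∧ |Complex.arg z| ≤ t)).card : ℕ) : ℝ) =
      (s.map fun z => if z = 0 then 0 else max 0 (a - |z.arg|)).sum := by
    have hz : ∀ z : ℂ, MeasureTheory.IntegrableOn (fun t : ℝ =>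
        if z ≠ 0 ∧ |z.arg| ≤ t then (1 : ℝ) else 0) (Set.Ioc 0 a) ∧
        ∫ t in Set.Ioc 0 a, (if z ≠ 0 ∧ |z.arg| ≤ t then (1 : ℝ) else 0) =
          if z = 0 then 0 else max 0 (a - |z.arg|) := fun z => by
      rcases eq_or_ne z 0 with rfl | hz
      · simp
      · simpa [hz] using integral_indicator_le a (abs_nonneg z.arg)
    rw [intervalIntegral.integral_of_le ha0.le]
    simp only [← (hz _).2]
    rw [← (integrable_and_integral_multiset_sum s _ fun z _ => (hz z).1).2]
    congr 1 with t
    clear_value s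
    clear hs hcard hpos
    induction s using Multiset.induction_on with
    | empty => simp
    | cons z s ih =>
      rw [Multiset.map_cons, Multiset.sum_cons, ← ih, Multiset.filter_cons]
      split_ifs <;> simp [add_comm]
  have hterm := hpos.trans (Multiset.sum_map_le_sum_map _
    (fun z => a ^ 2 - 2 * Real.pi * (if z = 0 then 0 else max 0 (a - |z.arg|))) fun z _ => by
      rcases eq_or_ne z 0 with rfl | hz
      · simp [Complex.norm_exp]
        positivity
      · simpa only [hz, if_false] using
          (integral_log_norm_sub_log_norm_add_neg ha0.le hapi hz).le)
  rw [Multiset.sum_map_sub, Multiset.sum_map_mul_left, Multiset.map_const', Multiset.sum_replicate,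
    hcard, nsmul_eq_mul, ← key] at hterm
  rw [one_div_mul_eq_div, div_le_div_iff₀ ha0 (by positivity)]
  linarith
end
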